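/- arXiv:1408.4885 — 5 statements merged into one kernel-verified Lean document; each statement's English description precedes it below -/
import Mathlib

section
/- Let G be an abelian group, let φ be a height on G, and let x ∈ (0,∞]. Then the x-metric version φ_x is itself a height on G satisfying the x-triangle inequality, and φ_x(α) ≤ φ(α) for all α ∈ G. -/
open scoped ENNReal

/-- A (logarithmic) height on a multiplicatively written abelian group `G`:
a nonnegative real-valued function with `φ 1 = 0` and `φ a⁻¹ = φ a`. -/
def IsHeight {G : Type*} [CommGroup G] (φ : G → ℝ) : Prop :=
  (∀ a : G, 0 ≤ φ a) ∧ φ 1 = 0 ∧ ∀ a : G, φ a⁻¹ = φ a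

/-- The value `(∑ φ(α_n)^x)^(1/x)` (resp. `max φ(α_n)` when `x = ∞`) of a
finite factorization, recorded as a list. -/
noncomputable def listVal {G : Type*} (φ : G → ℝ) (x : ℝ≥0∞) (l : List G) : ℝ :=
  if x = ⊤ then (l.map φ).foldr max 0
  else ((l.map fun g => φ g ^ x.toReal).sum) ^ (1 / x.toReal)

/-- The `x`-metric version `φ_x` of a height `φ`:
`φ_x(α) = inf { (∑ φ(α_n)^x)^(1/x) : α = α_1⋯α_N }` (max instead of sum-power if `x = ∞`). -/
noncomputable def metricHeight {G : Type*} [CommGroup G] (φ : G → ℝ) (x : ℝ≥0∞) (α : G) : ℝ :=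
  sInf { r : ℝ | ∃ l : List G, l.prod = α ∧ r = listVal φ x l }

/-- `φ` satisfies the `x`-triangle inequality (the strong triangle inequality when `x = ∞`). -/
def HasTriangleIneq {G : Type*} [CommGroup G] (φ : G → ℝ) (x : ℝ≥0∞) : Prop :=
  ∀ a b : G, φ (a * b) ≤
    if x = ⊤ then max (φ a) (φ b)
    else (φ a ^ x.toReal + φ b ^ x.toReal) ^ (1 / x.toReal)

theorem lv_nonneg {G : Type*} (φ : G → ℝ) (h0 : ∀ a, 0 ≤ φ a) (x : ℝ≥0∞) (l : List G) :
    0 ≤ listVal φ x l := by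
  unfold listVal
  split_ifs
  · induction l with
    | nil => simp
    | cons a l ih => simp only [List.map_cons, List.foldr_cons]; exact le_max_of_le_right ih
  · apply Real.rpow_nonneg
    apply List.sum_nonneg
    intro r hr
    obtain ⟨g, _, rfl⟩ := List.mem_map.1 hr
    exact Real.rpow_nonneg (h0 g) _

theorem lv_append_top {G : Type*} (φ : G → ℝ) (h0 : ∀ a, 0 ≤ φ a) (l m : List G) :
    listVal φ ⊤ (l ++ m) = max (listVal φ ⊤ l) (listVal φ ⊤ m) := by
  induction l with
  | nil =>
    have := lv_nonneg φ h0 ⊤ m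
    have h : listVal φ ⊤ ([] : List G) = 0 := by simp [listVal]
    rw [h, max_eq_right this]; rfl
  | cons a l ih =>
    have h : ∀ k : List G, listVal φ ⊤ (a :: k) = max (φ a) (listVal φ ⊤ k) := by
      intro k; simp [listVal]
    rw [List.cons_append, h, h, ih, max_assoc]

theorem lv_append {G : Type*} (φ : G → ℝ) (h0 : ∀ a, 0 ≤ φ a) (x : ℝ≥0∞) (hx : 0 < x)
    (hx' : x ≠ ⊤) (l m : List G) :
    listVal φ x (l ++ m) =
      (listVal φ x l ^ x.toReal + listVal φ x m ^ x.toReal) ^ (1 / x.toReal) := by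
  have hp : 0 < x.toReal := ENNReal.toReal_pos hx.ne' hx'
  have hs : ∀ k : List G, 0 ≤ (k.map fun g => φ g ^ x.toReal).sum := by
    intro k
    apply List.sum_nonneg
    intro r hr
    obtain ⟨g, _, rfl⟩ := List.mem_map.1 hr
    exact Real.rpow_nonneg (h0 g) _
  have hk : ∀ k : List G, listVal φ x k ^ x.toReal = (k.map fun g => φ g ^ x.toReal).sum := by
    intro k
    rw [listVal, if_neg hx', ← Real.rpow_mul (hs k), one_div, inv_mul_cancel₀ hp.ne',
      Real.rpow_one]
  rw [hk, hk, listVal, if_neg hx', List.map_append, List.sum_append]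

theorem lv_inv {G : Type*} [CommGroup G] (φ : G → ℝ) (hi : ∀ a, φ a⁻¹ = φ a) (x : ℝ≥0∞)
    (l : List G) : listVal φ x (l.map fun g => g⁻¹) = listVal φ x l := by
  simp [listVal, List.map_map, Function.comp_def, hi]

theorem lv_single {G : Type*} (φ : G → ℝ) (h0 : ∀ a, 0 ≤ φ a) (x : ℝ≥0∞) (hx : 0 < x) (a : G) :
    listVal φ x [a] = φ a := by
  unfold listVal
  split_ifs with h
  · simp [h0]
  · have hp : 0 < x.toReal := ENNReal.toReal_pos hx.ne' h
    simp only [List.map_cons, List.map_nil, List.sum_cons, List.sum_nil, add_zero]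
    rw [← Real.rpow_mul (h0 a), one_div, mul_inv_cancel₀ hp.ne', Real.rpow_one]

theorem mh_le {G : Type*} [CommGroup G] (φ : G → ℝ) (h0 : ∀ a, 0 ≤ φ a) (x : ℝ≥0∞)
    (l : List G) : metricHeight φ x l.prod ≤ listVal φ x l := by
  apply csInf_le
  · refine ⟨0, ?_⟩
    rintro r ⟨k, _, rfl⟩
    exact lv_nonneg φ h0 x k
  · exact ⟨l, rfl, rfl⟩

theorem mh_nonneg {G : Type*} [CommGroup G] (φ : G → ℝ) (h0 : ∀ a, 0 ≤ φ a) (x : ℝ≥0∞)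
    (a : G) : 0 ≤ metricHeight φ x a := by
  apply Real.sInf_nonneg
  rintro r ⟨k, _, rfl⟩
  exact lv_nonneg φ h0 x k

theorem mh_exists {G : Type*} [CommGroup G] (φ : G → ℝ) (x : ℝ≥0∞)
    (a : G) (ε : ℝ) (hε : 0 < ε) :
    ∃ l : List G, l.prod = a ∧ listVal φ x l < metricHeight φ x a + ε := by
  have hne : { r : ℝ | ∃ l : List G, l.prod = a ∧ r = listVal φ x l }.Nonempty :=
    ⟨_, [a], by simp, rfl⟩
  obtain ⟨r, ⟨l, h1, rfl⟩, h2⟩ := Real.lt_sInf_add_pos hne hε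
  exact ⟨l, h1, h2⟩

theorem mh_inv_le {G : Type*} [CommGroup G] (φ : G → ℝ) (hφ : IsHeight φ) (x : ℝ≥0∞)
    (a : G) : metricHeight φ x a⁻¹ ≤ metricHeight φ x a := by
  apply le_of_forall_pos_le_add
  intro ε hε
  obtain ⟨l, rfl, h⟩ := mh_exists φ x a ε hε
  have := mh_le φ hφ.1 x (l.map fun g => g⁻¹)
  rw [lv_inv φ hφ.2.2] at this
  have e : (l.map fun g => g⁻¹).prod = l.prod⁻¹ := by
    rw [List.prod_inv]
  rw [e] at this
  linarith

/-- For a height `φ` on `G` and `x ∈ (0,∞]`, the `x`-metric version `φ_x` is itself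
a height satisfying the `x`-triangle inequality, and `φ_x ≤ φ` pointwise. -/
theorem stmt_5 {G : Type*} [CommGroup G] (φ : G → ℝ) (hφ : IsHeight φ)
    (x : ℝ≥0∞) (hx : 0 < x) :
    IsHeight (metricHeight φ x) ∧ HasTriangleIneq (metricHeight φ x) x ∧
      ∀ a : G, metricHeight φ x a ≤ φ a := by
  have h0 := hφ.1
  have hle : ∀ a : G, metricHeight φ x a ≤ φ a := by
    intro a
    have := mh_le φ h0 x [a]
    rwa [lv_single φ h0 x hx, List.prod_singleton] at this
  refine ⟨⟨mh_nonneg φ h0 x, ?_, ?_⟩, ?_, hle⟩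
  · apply le_antisymm _ (mh_nonneg φ h0 x 1)
    rw [← hφ.2.1]; exact hle 1
  · intro a
    apply le_antisymm (mh_inv_le φ hφ x a)
    have := mh_inv_le φ hφ x a⁻¹
    rwa [inv_inv] at this
  · intro a b
    split_ifs with hT
    · subst hT
      apply le_of_forall_pos_le_add
      intro ε hε
      obtain ⟨l, rfl, h1⟩ := mh_exists φ ⊤ a ε hε
      obtain ⟨m, rfl, h2⟩ := mh_exists φ ⊤ b ε hε
      have := mh_le φ h0 ⊤ (l ++ m)
      rw [lv_append_top φ h0, List.prod_append] at this
      rw [← max_add_add_right]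
      exact this.trans (max_le_max h1.le h2.le)
    · have hp : 0 < x.toReal := ENNReal.toReal_pos hx.ne' hT
      have hc : Continuous fun ε : ℝ => ((metricHeight φ x a + ε) ^ x.toReal +
          (metricHeight φ x b + ε) ^ x.toReal) ^ (1 / x.toReal) := by
        refine (Real.continuous_rpow_const (by positivity)).comp ?_
        exact ((Real.continuous_rpow_const hp.le).comp (by fun_prop)).add
          ((Real.continuous_rpow_const hp.le).comp (by fun_prop))
      have ht := (hc.tendsto 0).mono_left (nhdsWithin_le_nhds (s := Set.Ioi 0))
      simp only [add_zero] at ht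
      refine ge_of_tendsto ht ?_
      filter_upwards [self_mem_nhdsWithin] with ε hε
      obtain ⟨l, hl, h1⟩ := mh_exists φ x a ε hε
      obtain ⟨m, hm, h2⟩ := mh_exists φ x b ε hε
      have := mh_le φ h0 x (l ++ m)
      rw [lv_append φ h0 x hx hT, List.prod_append, hl, hm] at this
      refine this.trans ?_
      have n1 := lv_nonneg φ h0 x l
      have n2 := lv_nonneg φ h0 x m
      gcongr
end

section
/- Let G be an abelian group, let φ be a height on G, and let x ∈ (0,∞]. If ψ is a height on G satisfying the x-triangle inequality and ψ(α) ≤ φ(α) for all α ∈ G, then ψ(α) ≤ φ_x(α) for all α ∈ G. -/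
open scoped ENNReal

/-- If `ψ` is a height satisfying the `x`-triangle inequality with `ψ ≤ φ` pointwise,
then `ψ ≤ φ_x` pointwise. -/
theorem stmt_6 {G : Type*} [CommGroup G] (φ ψ : G → ℝ) (hφ : IsHeight φ)
    (x : ℝ≥0∞) (hx : 0 < x) (hψ : IsHeight ψ) (hψtri : HasTriangleIneq ψ x)
    (hle : ∀ a : G, ψ a ≤ φ a) :
    ∀ a : G, ψ a ≤ metricHeight φ x a := by
  intro a
  have h0 := hψ.1
  have hf0 := hφ.1
  apply le_csInf
  · exact ⟨_, [a], by simp, rfl⟩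
  rintro r ⟨l, rfl, rfl⟩
  unfold listVal
  unfold HasTriangleIneq at hψtri
  by_cases hxt : x = ⊤
  · simp only [hxt, if_true] at hψtri ⊢
    induction l with
    | nil => simp [hψ.2.1]
    | cons b l ih =>
      simp only [List.prod_cons, List.map_cons, List.foldr_cons]
      exact (hψtri _ _).trans (max_le_max (hle b) ih)
  · simp only [hxt, if_false] at hψtri ⊢
    have hp : 0 < x.toReal := ENNReal.toReal_pos hx.ne' hxt
    generalize x.toReal = p at *
    have hs : ∀ l : List G, 0 ≤ (l.map fun g => φ g ^ p).sum := by
      intro l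
      apply List.sum_nonneg
      intro y hy
      obtain ⟨g, -, rfl⟩ := List.mem_map.1 hy
      exact Real.rpow_nonneg (hf0 g) p
    induction l with
    | nil => simp [hψ.2.1, hp.ne']
    | cons b l ih =>
      simp only [List.prod_cons, List.map_cons, List.sum_cons]
      refine (hψtri _ _).trans (Real.rpow_le_rpow ?_ (add_le_add ?_ ?_) (by positivity))
      · exact add_nonneg (Real.rpow_nonneg (h0 _) _) (Real.rpow_nonneg (h0 _) _)
      · exact Real.rpow_le_rpow (h0 _) (hle b) hp.le
      · have := Real.rpow_le_rpow (h0 _) ih hp.le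
        rwa [← Real.rpow_mul (hs l), one_div_mul_cancel hp.ne', Real.rpow_one] at this
end

section
/- Let G be an abelian group and let φ be a height on G. Then for each α ∈ G the limit φ_0(α) = lim_{x→0⁺} φ_x(α) exists, and the height φ_0 satisfies (φ_0)_x = φ_x for all x ∈ (0,∞] (i.e., φ_0 ∈ 𝒮(φ)). Moreover, if ψ is any height on G with ψ_x = φ_x for all x ∈ (0,∞], then ψ(α) ≥ φ_0(α) for all α ∈ G; that is, φ_0 is the minimal element of 𝒮(φ). -/
open scoped ENNReal

set_option linter.unusedSectionVars false

namespace Aux9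

variable {G : Type*} [CommGroup G]

/-- The value for a real exponent. -/
noncomputable def V (φ : G → ℝ) (p : ℝ) (l : List G) : ℝ :=
  (l.map fun g => φ g ^ p).sum

lemma V_nonneg {φ : G → ℝ} (h : ∀ a, 0 ≤ φ a) (p : ℝ) (l : List G) : 0 ≤ V φ p l := by
  apply List.sum_nonneg
  intro y hy
  obtain ⟨g, -, rfl⟩ := List.mem_map.1 hy
  exact Real.rpow_nonneg (h g) p

lemma V_cons (φ : G → ℝ) (p : ℝ) (g : G) (l : List G) :
    V φ p (g :: l) = φ g ^ p + V φ p l := by simp [V]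

lemma V_append (φ : G → ℝ) (p : ℝ) (l m : List G) :
    V φ p (l ++ m) = V φ p l + V φ p m := by simp [V]

lemma lv_real (φ : G → ℝ) {p : ℝ} (hp : 0 < p) (l : List G) :
    listVal φ (ENNReal.ofReal p) l = V φ p l ^ (1 / p) := by
  simp [listVal, V, ENNReal.toReal_ofReal hp.le]

lemma lv_top_nil (φ : G → ℝ) : listVal φ ⊤ [] = 0 := by simp [listVal]

lemma lv_top_cons (φ : G → ℝ) (g : G) (l : List G) :
    listVal φ ⊤ (g :: l) = max (φ g) (listVal φ ⊤ l) := by simp [listVal]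

lemma lv_top_nonneg (φ : G → ℝ) (l : List G) : 0 ≤ listVal φ ⊤ l := by
  induction l with
  | nil => simp [lv_top_nil]
  | cons g l ih => rw [lv_top_cons]; exact le_max_of_le_right ih

lemma lv_top_append (φ : G → ℝ) (l m : List G) :
    listVal φ ⊤ (l ++ m) = max (listVal φ ⊤ l) (listVal φ ⊤ m) := by
  induction l with
  | nil => simp [lv_top_nil, lv_top_nonneg]
  | cons g l ih => rw [List.cons_append, lv_top_cons, lv_top_cons, ih, max_assoc]

lemma cases_x (x : ℝ≥0∞) (hx : 0 < x) : x = ⊤ ∨ ∃ p : ℝ, 0 < p ∧ x = ENNReal.ofReal p := by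
  by_cases h : x = ⊤
  · exact Or.inl h
  · exact Or.inr ⟨x.toReal, ENNReal.toReal_pos hx.ne' h, (ENNReal.ofReal_toReal h).symm⟩

lemma lv_nonneg {φ : G → ℝ} (h : ∀ a, 0 ≤ φ a) {x : ℝ≥0∞} (hx : 0 < x) (l : List G) :
    0 ≤ listVal φ x l := by
  obtain rfl | ⟨p, hp, rfl⟩ := cases_x x hx
  · exact lv_top_nonneg φ l
  · rw [lv_real φ hp]; exact Real.rpow_nonneg (V_nonneg h p l) _

lemma V_mono {φ ψ : G → ℝ} (h : ∀ a, 0 ≤ φ a) (hle : ∀ a, φ a ≤ ψ a) {p : ℝ} (hp : 0 < p)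
    (l : List G) : V φ p l ≤ V ψ p l := by
  induction l with
  | nil => simp [V]
  | cons g l ih =>
    rw [V_cons, V_cons]
    exact add_le_add (Real.rpow_le_rpow (h g) (hle g) hp.le) ih

lemma lv_mono {φ ψ : G → ℝ} (h : ∀ a, 0 ≤ φ a) (hle : ∀ a, φ a ≤ ψ a) {x : ℝ≥0∞} (hx : 0 < x)
    (l : List G) : listVal φ x l ≤ listVal ψ x l := by
  obtain rfl | ⟨p, hp, rfl⟩ := cases_x x hx
  · induction l with
    | nil => simp [lv_top_nil]
    | cons g l ih => rw [lv_top_cons, lv_top_cons]; exact max_le_max (hle g) ih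
  · rw [lv_real φ hp, lv_real ψ hp]
    exact Real.rpow_le_rpow (V_nonneg h p l) (V_mono h hle hp l) (by positivity)

lemma add_anti {a b p q : ℝ} (ha : 0 ≤ a) (hb : 0 ≤ b) (hp : 0 < p) (hpq : p ≤ q) :
    (a ^ q + b ^ q) ^ (1 / q) ≤ (a ^ p + b ^ p) ^ (1 / p) := by
  lift a to NNReal using ha
  lift b to NNReal using hb
  exact_mod_cast NNReal.rpow_add_rpow_le a b hp hpq

lemma rr {a p : ℝ} (ha : 0 ≤ a) (hp : 0 < p) : (a ^ (1 / p)) ^ p = a := by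
  rw [one_div, Real.rpow_inv_rpow ha hp.ne']

lemma rr' {a p : ℝ} (ha : 0 ≤ a) (hp : 0 < p) : (a ^ p) ^ (1 / p) = a := by
  rw [one_div, Real.rpow_rpow_inv ha hp.ne']

lemma V_anti {φ : G → ℝ} (h : ∀ a, 0 ≤ φ a) {p q : ℝ} (hp : 0 < p) (hpq : p ≤ q) (l : List G) :
    V φ q l ^ (1 / q) ≤ V φ p l ^ (1 / p) := by
  have hq : 0 < q := hp.trans_le hpq
  induction l with
  | nil =>
    have h1 : p⁻¹ ≠ 0 := by positivity
    have h2 : q⁻¹ ≠ 0 := by positivity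
    simp [V, Real.zero_rpow, h1, h2]
  | cons g l ih =>
    rw [V_cons, V_cons]
    have hn := V_nonneg h q l
    have hn' := V_nonneg h p l
    have hg := h g
    calc (φ g ^ q + V φ q l) ^ (1 / q)
        = (φ g ^ q + (V φ q l ^ (1 / q)) ^ q) ^ (1 / q) := by rw [rr hn hq]
      _ ≤ (φ g ^ q + (V φ p l ^ (1 / p)) ^ q) ^ (1 / q) := by gcongr
      _ ≤ (φ g ^ p + (V φ p l ^ (1 / p)) ^ p) ^ (1 / p) :=
          add_anti hg (by positivity) hp hpq
      _ = _ := by rw [rr hn' hp]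

lemma top_le {φ : G → ℝ} (h : ∀ a, 0 ≤ φ a) {p : ℝ} (hp : 0 < p) (l : List G) :
    listVal φ ⊤ l ≤ V φ p l ^ (1 / p) := by
  induction l with
  | nil => rw [lv_top_nil]; exact Real.rpow_nonneg (V_nonneg h p _) _
  | cons g l ih =>
    have hn := V_nonneg h p l
    have hg := h g
    have hg' : 0 ≤ φ g ^ p := Real.rpow_nonneg hg p
    rw [lv_top_cons, V_cons]
    apply max_le
    · calc φ g = (φ g ^ p) ^ (1 / p) := (rr' hg hp).symm
        _ ≤ _ := Real.rpow_le_rpow hg' (by linarith) (by positivity)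
    · exact ih.trans (Real.rpow_le_rpow hn (by linarith) (by positivity))

lemma lv_single {φ : G → ℝ} (h : ∀ a, 0 ≤ φ a) {x : ℝ≥0∞} (hx : 0 < x) (a : G) :
    listVal φ x [a] = φ a := by
  obtain rfl | ⟨p, hp, rfl⟩ := cases_x x hx
  · rw [lv_top_cons, lv_top_nil, max_eq_left (h a)]
  · rw [lv_real φ hp, V_cons]
    simp only [V, List.map_nil, List.sum_nil, add_zero]
    exact rr' (h a) hp

lemma mh_le {φ : G → ℝ} (h : ∀ a, 0 ≤ φ a) {x : ℝ≥0∞} (hx : 0 < x) {α : G} (l : List G)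
    (hl : l.prod = α) : metricHeight φ x α ≤ listVal φ x l := by
  apply csInf_le
  · refine ⟨0, ?_⟩
    rintro r ⟨m, -, rfl⟩
    exact lv_nonneg h hx m
  · exact ⟨l, hl, rfl⟩

lemma le_mh {φ : G → ℝ} {x : ℝ≥0∞} {α : G} {c : ℝ}
    (hc : ∀ l : List G, l.prod = α → c ≤ listVal φ x l) : c ≤ metricHeight φ x α := by
  apply le_csInf
  · exact ⟨_, [α], by simp, rfl⟩
  · rintro r ⟨m, hm, rfl⟩
    exact hc m hm

lemma mh_nonneg {φ : G → ℝ} (h : ∀ a, 0 ≤ φ a) {x : ℝ≥0∞} (hx : 0 < x) (α : G) :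
    0 ≤ metricHeight φ x α := le_mh fun l _ => lv_nonneg h hx l

lemma mh_le_self {φ : G → ℝ} (h : ∀ a, 0 ≤ φ a) {x : ℝ≥0∞} (hx : 0 < x) (α : G) :
    metricHeight φ x α ≤ φ α :=
  (mh_le h hx [α] (by simp)).trans_eq (lv_single h hx α)

lemma mh_mono {φ ψ : G → ℝ} (h : ∀ a, 0 ≤ φ a) (hle : ∀ a, φ a ≤ ψ a) {x : ℝ≥0∞} (hx : 0 < x)
    (α : G) : metricHeight φ x α ≤ metricHeight ψ x α :=
  le_mh fun l hl => (mh_le h hx l hl).trans (lv_mono h hle hx l)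

lemma mh_anti {φ : G → ℝ} (h : ∀ a, 0 ≤ φ a) {p q : ℝ} (hp : 0 < p) (hpq : p ≤ q) (α : G) :
    metricHeight φ (ENNReal.ofReal q) α ≤ metricHeight φ (ENNReal.ofReal p) α := by
  have hq : 0 < q := hp.trans_le hpq
  refine le_mh fun l hl => (mh_le h (ENNReal.ofReal_pos.2 hq) l hl).trans ?_
  rw [lv_real φ hp, lv_real φ hq]
  exact V_anti h hp hpq l

lemma mh_top_le {φ : G → ℝ} (h : ∀ a, 0 ≤ φ a) {p : ℝ} (hp : 0 < p) (α : G) :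
    metricHeight φ ⊤ α ≤ metricHeight φ (ENNReal.ofReal p) α := by
  refine le_mh fun l hl => (mh_le h (by simp) l hl).trans ?_
  rw [lv_real φ hp]
  exact top_le h hp l

lemma mh_inv_le {φ : G → ℝ} (hφ : IsHeight φ) {x : ℝ≥0∞} (hx : 0 < x) (α : G) :
    metricHeight φ x α⁻¹ ≤ metricHeight φ x α := by
  refine le_mh fun l hl => ?_
  have e : listVal φ x (l.map (·⁻¹)) = listVal φ x l := by
    simp [listVal, Function.comp_def, hφ.2.2]
  rw [← e]
  apply mh_le hφ.1 hx
  rw [← hl, List.prod_inv]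

lemma mh_inv {φ : G → ℝ} (hφ : IsHeight φ) {x : ℝ≥0∞} (hx : 0 < x) (α : G) :
    metricHeight φ x α⁻¹ = metricHeight φ x α := by
  apply le_antisymm (mh_inv_le hφ hx α)
  simpa using mh_inv_le hφ hx α⁻¹

lemma le_mh_pow {φ : G → ℝ} (h : ∀ a, 0 ≤ φ a) {p : ℝ} (hp : 0 < p) {α : G} {c : ℝ}
    (hc : ∀ l : List G, l.prod = α → c ≤ V φ p l) :
    c ≤ metricHeight φ (ENNReal.ofReal p) α ^ p := by
  have hM := mh_nonneg h (ENNReal.ofReal_pos.2 hp) α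
  rcases le_or_gt c 0 with h0 | h0
  · exact h0.trans (Real.rpow_nonneg hM p)
  · have : c ^ (1 / p) ≤ metricHeight φ (ENNReal.ofReal p) α := by
      refine le_mh fun l hl => ?_
      rw [lv_real φ hp]
      exact Real.rpow_le_rpow h0.le (hc l hl) (by positivity)
    calc c = (c ^ (1 / p)) ^ p := (rr h0.le hp).symm
      _ ≤ _ := Real.rpow_le_rpow (by positivity) this hp.le

lemma tri_real {φ : G → ℝ} (h : ∀ a, 0 ≤ φ a) {p : ℝ} (hp : 0 < p) (a b : G) :
    metricHeight φ (ENNReal.ofReal p) (a * b) ^ p ≤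
      metricHeight φ (ENNReal.ofReal p) a ^ p + metricHeight φ (ENNReal.ofReal p) b ^ p := by
  have hx := ENNReal.ofReal_pos.2 hp
  rw [← sub_le_iff_le_add]
  refine le_mh_pow h hp fun la hla => ?_
  rw [sub_le_comm]
  refine le_mh_pow h hp fun lb hlb => ?_
  rw [sub_le_iff_le_add, add_comm, ← V_append]
  have := mh_le h hx (la ++ lb) (α := a * b) (by simp [hla, hlb])
  rw [lv_real φ hp] at this
  calc _ ≤ (V φ p (la ++ lb) ^ (1 / p)) ^ p :=
        Real.rpow_le_rpow (mh_nonneg h hx _) this hp.le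
    _ = _ := rr (V_nonneg h p _) hp

lemma exists_lt {φ : G → ℝ} {x : ℝ≥0∞} {α : G} {c : ℝ} (hc : metricHeight φ x α < c) :
    ∃ l : List G, l.prod = α ∧ listVal φ x l < c := by
  by_contra! H
  exact absurd (le_mh H) (not_le.2 hc)

lemma tri_top {φ : G → ℝ} (h : ∀ a, 0 ≤ φ a) (a b : G) :
    metricHeight φ ⊤ (a * b) ≤ max (metricHeight φ ⊤ a) (metricHeight φ ⊤ b) := by
  by_contra! H
  obtain ⟨h1, h2⟩ := max_lt_iff.1 H
  obtain ⟨la, hla, h1⟩ := exists_lt h1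
  obtain ⟨lb, hlb, h2⟩ := exists_lt h2
  have := mh_le h (x := ⊤) (by simp) (la ++ lb) (α := a * b) (by simp [hla, hlb])
  rw [lv_top_append] at this
  exact absurd this (not_le.2 (max_lt h1 h2))

lemma mh_one {φ : G → ℝ} (hφ : IsHeight φ) {x : ℝ≥0∞} (hx : 0 < x) :
    metricHeight φ x 1 = 0 :=
  le_antisymm ((mh_le_self hφ.1 hx 1).trans_eq hφ.2.1) (mh_nonneg hφ.1 hx 1)

lemma mh_prod_le {φ : G → ℝ} (hφ : IsHeight φ) {x : ℝ≥0∞} (hx : 0 < x) (l : List G) :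
    metricHeight φ x l.prod ≤ listVal (metricHeight φ x) x l := by
  have h := hφ.1
  obtain rfl | ⟨p, hp, rfl⟩ := cases_x x hx
  · induction l with
    | nil => simp [lv_top_nil, mh_one hφ hx]
    | cons g l ih =>
      rw [lv_top_cons, List.prod_cons]
      exact (tri_top h g l.prod).trans (max_le_max le_rfl ih)
  · rw [lv_real _ hp]
    have key : metricHeight φ (ENNReal.ofReal p) l.prod ^ p ≤
        V (metricHeight φ (ENNReal.ofReal p)) p l := by
      induction l with
      | nil => simp [V, mh_one hφ hx, Real.zero_rpow hp.ne']
      | cons g l ih =>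
        rw [V_cons, List.prod_cons]
        exact (tri_real h hp g l.prod).trans (by gcongr)
    have hM := mh_nonneg h hx l.prod
    calc _ = (metricHeight φ (ENNReal.ofReal p) l.prod ^ p) ^ (1 / p) := (rr' hM hp).symm
      _ ≤ _ := Real.rpow_le_rpow (Real.rpow_nonneg hM p) key (by positivity)

end Aux9

/-- For a height `φ` on `G`, the limit `φ_0(α) = lim_{x→0⁺} φ_x(α)` exists; `φ_0` is a
height with `(φ_0)_x = φ_x` for all `x ∈ (0,∞]` (i.e., `φ_0 ∈ 𝒮(φ)`); and any height
`ψ` with `ψ_x = φ_x` for all `x ∈ (0,∞]` satisfies `ψ ≥ φ_0` pointwise. -/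
theorem stmt_9 {G : Type*} [CommGroup G] (φ : G → ℝ) (hφ : IsHeight φ) :
    ∃ L : G → ℝ,
      (∀ α : G, Filter.Tendsto (fun x : ℝ => metricHeight φ (ENNReal.ofReal x) α)
        (nhdsWithin 0 (Set.Ioi 0)) (nhds (L α))) ∧
      IsHeight L ∧
      (∀ x : ℝ≥0∞, 0 < x → ∀ α : G, metricHeight L x α = metricHeight φ x α) ∧
      (∀ ψ : G → ℝ, IsHeight ψ →
        (∀ x : ℝ≥0∞, 0 < x → ∀ α : G, metricHeight ψ x α = metricHeight φ x α) →
        ∀ α : G, L α ≤ ψ α) := by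
  have h := hφ.1
  have pos : ∀ {p : ℝ}, 0 < p → 0 < ENNReal.ofReal p := fun hp => ENNReal.ofReal_pos.2 hp
  let f : G → ℝ → ℝ := fun α x => metricHeight φ (ENNReal.ofReal x) α
  let L : G → ℝ := fun α => sSup (f α '' Set.Ioi 0)
  have bdd : ∀ α, BddAbove (f α '' Set.Ioi 0) := by
    intro α
    refine ⟨φ α, ?_⟩
    rintro _ ⟨p, hp, rfl⟩
    exact Aux9.mh_le_self h (pos hp) α
  have ne : ∀ α, (f α '' Set.Ioi 0).Nonempty := fun α => ⟨_, 1, by simp, rfl⟩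
  have Lle : ∀ α c, (∀ p : ℝ, 0 < p → f α p ≤ c) → L α ≤ c := by
    intro α c hc
    apply csSup_le (ne α)
    rintro _ ⟨p, hp, rfl⟩
    exact hc p hp
  have leL : ∀ α (p : ℝ), 0 < p → f α p ≤ L α := fun α p hp =>
    le_csSup (bdd α) ⟨p, hp, rfl⟩
  have Lφ : ∀ α, L α ≤ φ α := fun α => Lle α _ fun p hp => Aux9.mh_le_self h (pos hp) α
  have L0 : ∀ α, 0 ≤ L α := fun α =>
    (Aux9.mh_nonneg h (pos one_pos) α).trans (leL α 1 one_pos)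
  have leL' : ∀ x : ℝ≥0∞, 0 < x → ∀ α, metricHeight φ x α ≤ L α := by
    intro x hx α
    obtain rfl | ⟨p, hp, rfl⟩ := Aux9.cases_x x hx
    · exact (Aux9.mh_top_le h one_pos α).trans (leL α 1 one_pos)
    · exact leL α p hp
  refine ⟨L, ?_, ⟨L0, ?_, ?_⟩, ?_, ?_⟩
  · intro α
    have anti : AntitoneOn (f α) (Set.Ioi 0) := fun p hp q _ hpq => Aux9.mh_anti h hp hpq α
    exact anti.tendsto_nhdsGT (bdd α)
  · exact le_antisymm ((Lφ 1).trans_eq hφ.2.1) (L0 1)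
  · intro a
    apply le_antisymm
    · exact Lle _ _ fun p hp => (Aux9.mh_inv hφ (pos hp) a).trans_le (leL a p hp)
    · exact Lle _ _ fun p hp => (Aux9.mh_inv hφ (pos hp) a).symm.trans_le (leL a⁻¹ p hp)
  · intro x hx α
    apply le_antisymm (Aux9.mh_mono L0 Lφ hx α)
    refine Aux9.le_mh fun l hl => ?_
    rw [← hl]
    exact (Aux9.mh_prod_le hφ hx l).trans
      (Aux9.lv_mono (Aux9.mh_nonneg h hx) (leL' x hx) hx l)
  · intro ψ hψ he α
    refine Lle _ _ fun p hp => ?_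
    exact (he _ (pos hp) α).symm.trans_le (Aux9.mh_le_self hψ.1 (pos hp) α)
end

section
/- Let G be an abelian group and let φ be a height on G. Define the modified version of φ by φ̄(α) = inf{φ(ζα) : ζ ∈ Z(φ)}, where Z(φ) = {ζ ∈ G : φ(ζ) = 0}. Then φ̄ is a height on G and (φ̄)_x = φ_x for all x ∈ (0,∞]; that is, φ̄ ∈ 𝒮(φ). -/
open scoped ENNReal

/-- The modified version `φ̄(α) = inf { φ(ζα) : ζ ∈ Z(φ) }` of a height `φ`. -/
noncomputable def modHeight {G : Type*} [CommGroup G] (φ : G → ℝ) (α : G) : ℝ :=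
  sInf { r : ℝ | ∃ ζ : G, φ ζ = 0 ∧ r = φ (ζ * α) }

theorem aux_bdd {G : Type*} [CommGroup G] {φ : G → ℝ} (hφ : IsHeight φ) (α : G) :
    BddBelow { r : ℝ | ∃ ζ : G, φ ζ = 0 ∧ r = φ (ζ * α) } :=
  ⟨0, by rintro r ⟨ζ, _, rfl⟩; exact hφ.1 _⟩

theorem aux_le {G : Type*} [CommGroup G] {φ : G → ℝ} (hφ : IsHeight φ) (α : G) :
    modHeight φ α ≤ φ α :=
  csInf_le (aux_bdd hφ α) ⟨1, hφ.2.1, by simp⟩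

theorem aux_nonneg {G : Type*} [CommGroup G] {φ : G → ℝ} (hφ : IsHeight φ) (α : G) :
    0 ≤ modHeight φ α :=
  Real.sInf_nonneg (by rintro r ⟨ζ, _, rfl⟩; exact hφ.1 _)

theorem aux_height {G : Type*} [CommGroup G] {φ : G → ℝ} (hφ : IsHeight φ) :
    IsHeight (modHeight φ) := by
  refine ⟨aux_nonneg hφ, ?_, ?_⟩
  · exact le_antisymm ((aux_le hφ 1).trans_eq hφ.2.1) (aux_nonneg hφ 1)
  · intro a
    unfold modHeight
    congr 1
    ext r
    constructor
    · rintro ⟨ζ, h, rfl⟩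
      refine ⟨ζ⁻¹, by rw [hφ.2.2, h], ?_⟩
      rw [← hφ.2.2 (ζ * a⁻¹)]; simp [mul_comm]
    · rintro ⟨ζ, h, rfl⟩
      refine ⟨ζ⁻¹, by rw [hφ.2.2, h], ?_⟩
      rw [← hφ.2.2 (ζ * a)]; simp [mul_comm]

theorem aux_sum_nonneg {G : Type*} {f : G → ℝ} (hf : ∀ g, 0 ≤ f g) (t : ℝ) (l : List G) :
    0 ≤ (l.map fun g => f g ^ t).sum :=
  List.sum_nonneg (by
    intro r hr
    obtain ⟨g, _, rfl⟩ := List.mem_map.1 hr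
    exact Real.rpow_nonneg (hf g) _)

theorem aux_foldr_nonneg (l : List ℝ) : 0 ≤ l.foldr max 0 := by
  induction l with
  | nil => simp
  | cons a l ih => simp [ih]

theorem aux_val_nonneg {G : Type*} {f : G → ℝ} (hf : ∀ g, 0 ≤ f g) (x : ℝ≥0∞) (l : List G) :
    0 ≤ listVal f x l := by
  unfold listVal
  split_ifs
  · exact aux_foldr_nonneg _
  · exact Real.rpow_nonneg (aux_sum_nonneg hf _ l) _

theorem aux_mono {G : Type*} {f h : G → ℝ} (hf : ∀ g, 0 ≤ f g) (hfh : ∀ g, f g ≤ h g)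
    (x : ℝ≥0∞) (l : List G) : listVal f x l ≤ listVal h x l := by
  unfold listVal
  split_ifs with hx
  · induction l with
    | nil => simp
    | cons a l ih =>
      simp only [List.map_cons, List.foldr_cons]
      exact max_le_max (hfh a) ih
  · refine Real.rpow_le_rpow (aux_sum_nonneg hf _ l) ?_ (by positivity)
    exact List.sum_le_sum fun g _ => Real.rpow_le_rpow (hf g) (hfh g) ENNReal.toReal_nonneg

theorem aux_cont {G : Type*} (f : G → ℝ) {x : ℝ≥0∞} (hx : 0 < x) (l : List G) :
    Continuous fun ε : ℝ => listVal (fun g => f g + ε) x l := by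
  unfold listVal
  split_ifs with h
  · induction l with
    | nil => simpa using continuous_const
    | cons a l ih =>
      simp only [List.map_cons, List.foldr_cons]
      exact (continuous_const.add continuous_id).max ih
  · have hp : 0 < x.toReal := ENNReal.toReal_pos hx.ne' h
    refine Continuous.rpow_const ?_ fun _ => Or.inr (by positivity)
    induction l with
    | nil => simpa using continuous_const
    | cons a l ih =>
      simp only [List.map_cons, List.sum_cons]
      exact ((continuous_const.add continuous_id).rpow_const fun _ => Or.inr hp.le).add ih

theorem aux_append {G : Type*} [CommGroup G] {φ : G → ℝ} (hφ : IsHeight φ) {x : ℝ≥0∞}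
    (hx : 0 < x) (z : G → G) (hz : ∀ g, φ (z g) = 0) (l : List G) :
    listVal φ x (l.map (fun g => z g * g) ++ l.map (fun g => (z g)⁻¹)) =
      listVal (fun g => φ (z g * g)) x l := by
  have hz' : ∀ g, φ (z g)⁻¹ = 0 := fun g => by rw [hφ.2.2, hz]
  unfold listVal
  split_ifs with h
  · have h0 : ∀ l : List G, ((l.map (fun g => (z g)⁻¹)).map φ).foldr max 0 = 0 := by
      intro l
      induction l with
      | nil => simp
      | cons a l ih => simp only [List.map_cons, List.foldr_cons, ih, hz', max_self]
    rw [List.map_append, List.foldr_append, h0, List.map_map]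
    rfl
  · have hp : 0 < x.toReal := ENNReal.toReal_pos hx.ne' h
    have h0 : ((l.map (fun g => (z g)⁻¹)).map fun g => φ g ^ x.toReal).sum = 0 := by
      apply List.sum_eq_zero
      intro r hr
      simp only [List.map_map, List.mem_map, Function.comp] at hr
      obtain ⟨g, _, rfl⟩ := hr
      rw [hz', Real.zero_rpow hp.ne']
    rw [List.map_append, List.sum_append, h0, add_zero, List.map_map]
    rfl

theorem aux_prod {G : Type*} [CommGroup G] (z : G → G) (l : List G) :
    (l.map (fun g => z g * g) ++ l.map (fun g => (z g)⁻¹)).prod = l.prod := by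
  rw [List.prod_append, ← List.prod_map_mul]
  congr 1
  simp

theorem aux_metric_le {G : Type*} [CommGroup G] {φ : G → ℝ} (hφ : ∀ g, 0 ≤ φ g) (x : ℝ≥0∞)
    (l : List G) : metricHeight φ x l.prod ≤ listVal φ x l :=
  csInf_le ⟨0, by rintro r ⟨l, _, rfl⟩; exact aux_val_nonneg hφ x l⟩ ⟨l, rfl, rfl⟩

/-- The modified version `φ̄` of a height `φ` is a height and satisfies
`(φ̄)_x = φ_x` for all `x ∈ (0,∞]`; that is, `φ̄ ∈ 𝒮(φ)`. -/
theorem stmt_10 {G : Type*} [CommGroup G] (φ : G → ℝ) (hφ : IsHeight φ) :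
    IsHeight (modHeight φ) ∧
      ∀ x : ℝ≥0∞, 0 < x → ∀ α : G,
        metricHeight (modHeight φ) x α = metricHeight φ x α := by
  refine ⟨aux_height hφ, fun x hx α => le_antisymm ?_ ?_⟩
  · refine le_csInf ⟨_, [α], by simp, rfl⟩ ?_
    rintro r ⟨l, rfl, rfl⟩
    exact (aux_metric_le (aux_nonneg hφ) x l).trans
      (aux_mono (aux_nonneg hφ) (aux_le hφ) x l)
  · refine le_csInf ⟨_, [α], by simp, rfl⟩ ?_
    rintro r ⟨l, rfl, rfl⟩
    have hc := ((aux_cont (modHeight φ) hx l).tendsto 0).mono_left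
      (nhdsWithin_le_nhds (s := Set.Ioi 0))
    simp only [add_zero] at hc
    refine ge_of_tendsto hc ?_
    filter_upwards [self_mem_nhdsWithin] with ε hε
    have key : ∀ g : G, ∃ ζ : G, φ ζ = 0 ∧ φ (ζ * g) ≤ modHeight φ g + ε := by
      intro g
      have hlt : modHeight φ g < modHeight φ g + ε := lt_add_of_pos_right _ hε
      obtain ⟨r, ⟨ζ, h1, rfl⟩, h2⟩ :=
        exists_lt_of_csInf_lt (s := { r : ℝ | ∃ ζ : G, φ ζ = 0 ∧ r = φ (ζ * g) })
          ⟨_, 1, hφ.2.1, rfl⟩ hlt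
      exact ⟨ζ, h1, h2.le⟩
    choose z hz hz' using key
    have h1 := aux_metric_le hφ.1 x (l.map (fun g => z g * g) ++ l.map (fun g => (z g)⁻¹))
    rw [aux_prod, aux_append hφ hx z hz] at h1
    exact h1.trans (aux_mono (fun g => hφ.1 _) hz' x l)
end

section
/- Let G be an abelian group, let φ be a height on G, and let α ∈ G. Then the map x ↦ φ_x(α) is left semi-continuous at every point of (0,∞): for every x̄ > 0, lim_{x→x̄⁻} φ_x(α) = φ_{x̄}(α). -/
open scoped ENNReal

theorem lv_eq {G : Type*} (φ : G → ℝ) {x : ℝ} (hx : 0 < x) (l : List G) :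
    listVal φ (ENNReal.ofReal x) l = ((l.map fun g => φ g ^ x).sum) ^ (1 / x) := by
  simp [listVal, ENNReal.toReal_ofReal hx.le]

theorem sum_nn {G : Type*} (φ : G → ℝ) (h : ∀ a, 0 ≤ φ a) (x : ℝ) (l : List G) :
    0 ≤ (l.map fun g => φ g ^ x).sum := by
  apply List.sum_nonneg
  intro y hy
  obtain ⟨g, _, rfl⟩ := List.mem_map.1 hy
  exact Real.rpow_nonneg (h g) _

theorem lv_anti {G : Type*} (φ : G → ℝ) (h : ∀ a, 0 ≤ φ a) {x y : ℝ} (hx : 0 < x) (hxy : x ≤ y)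
    (l : List G) :
    ((l.map fun g => φ g ^ y).sum) ^ (1 / y) ≤ ((l.map fun g => φ g ^ x).sum) ^ (1 / x) := by
  have hy : 0 < y := hx.trans_le hxy
  induction l with
  | nil => simp [Real.zero_rpow, hx.ne', hy.ne']
  | cons a l ih =>
    simp only [List.map_cons, List.sum_cons]
    have hSx := sum_nn φ h x l
    have hSy := sum_nn φ h y l
    set S := (l.map fun g => φ g ^ x).sum
    set T := (l.map fun g => φ g ^ y).sum
    have hN : 0 ≤ S ^ (1 / x) := Real.rpow_nonneg hSx _
    have e1 : T = (T ^ (1 / y)) ^ y := by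
      rw [← Real.rpow_mul hSy, one_div_mul_cancel hy.ne', Real.rpow_one]
    have e2 : S = (S ^ (1 / x)) ^ x := by
      rw [← Real.rpow_mul hSx, one_div_mul_cancel hx.ne', Real.rpow_one]
    have h1 : T ≤ (S ^ (1 / x)) ^ y := by
      rw [e1]
      exact Real.rpow_le_rpow (Real.rpow_nonneg hSy _) ih hy.le
    have h2 := Real.rpow_add_rpow_le (h a) hN hx hxy
    rw [← e2] at h2
    refine le_trans ?_ h2
    have := Real.rpow_nonneg (h a) y
    exact Real.rpow_le_rpow (by positivity) (by linarith) (by positivity)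

theorem lv_cont {G : Type*} (φ : G → ℝ) {x : ℝ} (hx : 0 < x) (l : List G) :
    ContinuousAt (fun x : ℝ => ((l.map fun g => φ g ^ x).sum) ^ (1 / x)) x := by
  have h1 : ContinuousAt (fun x : ℝ => (l.map fun g => φ g ^ x).sum) x := by
    induction l with
    | nil => simpa using continuousAt_const
    | cons a l ih =>
      simp only [List.map_cons, List.sum_cons]
      exact (Real.continuousAt_const_rpow' hx.ne').add ih
  refine h1.rpow ?_ (Or.inr (by positivity))
  exact continuousAt_const.div continuousAt_id hx.ne'

theorem mh_bdd {G : Type*} [CommGroup G] (φ : G → ℝ) (h : ∀ a, 0 ≤ φ a) {x : ℝ} (hx : 0 < x)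
    (α : G) :
    BddBelow { r : ℝ | ∃ l : List G, l.prod = α ∧ r = listVal φ (ENNReal.ofReal x) l } := by
  refine ⟨0, ?_⟩
  rintro r ⟨l, _, rfl⟩
  rw [lv_eq φ hx]
  exact Real.rpow_nonneg (sum_nn φ h x l) _

theorem mh_ne {G : Type*} [CommGroup G] (φ : G → ℝ) (x : ENNReal) (α : G) :
    { r : ℝ | ∃ l : List G, l.prod = α ∧ r = listVal φ x l }.Nonempty :=
  ⟨_, [α], by simp, rfl⟩

/-- For a height `φ` on `G` and `α ∈ G`, the map `x ↦ φ_x(α)` is left semi-continuous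
at every `x̄ > 0`: the limit of `φ_x(α)` as `x → x̄⁻` equals `φ_{x̄}(α)`. -/
theorem stmt_11 {G : Type*} [CommGroup G] (φ : G → ℝ) (hφ : IsHeight φ) (α : G)
    (x₀ : ℝ) (hx₀ : 0 < x₀) :
    Filter.Tendsto (fun x : ℝ => metricHeight φ (ENNReal.ofReal x) α)
      (nhdsWithin x₀ (Set.Iio x₀)) (nhds (metricHeight φ (ENNReal.ofReal x₀) α)) := by
  have h := hφ.1
  have hpos : ∀ᶠ x in nhdsWithin x₀ (Set.Iio x₀), 0 < x :=
    nhdsWithin_le_nhds (lt_mem_nhds hx₀)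
  rw [tendsto_order]
  constructor
  · intro a ha
    filter_upwards [hpos, self_mem_nhdsWithin] with x hx hxx
    refine ha.trans_le (le_csInf (mh_ne φ _ α) ?_)
    rintro r ⟨l, hl, rfl⟩
    refine (csInf_le (mh_bdd φ h hx₀ α) ⟨l, hl, rfl⟩).trans ?_
    rw [lv_eq φ hx₀, lv_eq φ hx]
    exact lv_anti φ h hx (le_of_lt hxx) l
  · intro b hb
    obtain ⟨r, ⟨l, hl, rfl⟩, hr⟩ := exists_lt_of_csInf_lt (mh_ne φ _ α) hb
    rw [lv_eq φ hx₀] at hr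
    filter_upwards [hpos, nhdsWithin_le_nhds ((lv_cont φ hx₀ l).eventually_lt_const hr)]
      with x hx hxb
    refine lt_of_le_of_lt (csInf_le (mh_bdd φ h hx α) ⟨l, hl, rfl⟩) ?_
    rw [lv_eq φ hx]
    exact hxb
end
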